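/- Let m ≥ 3 and let S be the subdivision graph of the complete bipartite graph K_{m,m}. Then for every edge f = gh of S, the number of edges f' ≠ f equidistant from both endpoints satisfies m_0(f) = (m − 1)². -/

import Mathlib

open SimpleGraph


/-- Distance from a vertex to an edge (unordered pair): min of distances to the endpoints. -/
noncomputable def evdist {V : Type*} (G : SimpleGraph V) (g : V) (e : Sym2 V) : ℕ :=
  Sym2.lift ⟨fun u v => min (G.dist g u) (G.dist g v), fun _ _ => min_comm _ _⟩ e

/-- `mcount G g h` is the number of edges of `G` strictly closer to `g` than to `h`. -/
noncomputable def mcount {V : Type*} (G : SimpleGraph V) (g h : V) : ℕ :=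
  {e ∈ G.edgeSet | evdist G g e < evdist G h e}.ncard

/-- `m0count G g h` is the number of edges of `G`, other than `s(g,h)` itself, that are
equidistant from `g` and from `h`. -/
noncomputable def m0count {V : Type*} (G : SimpleGraph V) (g h : V) : ℕ :=
  {e ∈ G.edgeSet | e ≠ s(g, h) ∧ evdist G g e = evdist G h e}.ncard

/-- `ncount G g h` is the number of vertices of `G` strictly closer to `g` than to `h`. -/
noncomputable def ncount {V : Type*} (G : SimpleGraph V) (g h : V) : ℕ :=
  {w : V | G.dist w g < G.dist w h}.ncard

/-- Edge quasi-λ-distance-balanced. -/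
def IsEQDB {V : Type*} (G : SimpleGraph V) (lam : ℚ) : Prop :=
  ∀ g h : V, G.Adj g h →
    (mcount G g h : ℚ) = lam * mcount G h g ∨ (mcount G h g : ℚ) = lam * mcount G g h

/-- Quasi-λ-distance-balanced. -/
def IsQDB {V : Type*} (G : SimpleGraph V) (lam : ℚ) : Prop :=
  ∀ g h : V, G.Adj g h →
    (ncount G g h : ℚ) = lam * ncount G h g ∨ (ncount G h g : ℚ) = lam * ncount G g h


/-- The subdivision graph `S(G)`: vertices are `V(G) ⊕ E(G)`, with an original vertex adjacent
to a subdivision vertex iff it is an endpoint of the corresponding edge. -/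
def subdivision {V : Type*} (G : SimpleGraph V) : SimpleGraph (V ⊕ G.edgeSet) where
  Adj x y :=
    match x, y with
    | Sum.inl v, Sum.inr e => v ∈ (e : Sym2 V)
    | Sum.inr e, Sum.inl v => v ∈ (e : Sym2 V)
    | _, _ => False
  symm := ⟨by rintro (v | e) (w | f) h <;> exact h⟩
  loopless := ⟨by rintro (v | e) h <;> exact h⟩

namespace SimpleGraph

/-- A function that changes by at most one along edges and decreases towards its zero `g` is the
distance from `g`. -/
theorem dist_eq_of_potential {V : Type*} {G : SimpleGraph V} {g : V} (φ : V → ℕ) (hg : φ g = 0)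
    (hadj : ∀ x y, G.Adj x y → φ y ≤ φ x + 1)
    (hdesc : ∀ x, x ≠ g → ∃ y, G.Adj y x ∧ φ x = φ y + 1) (x : V) :
    G.dist g x = φ x := by
  have hwalk : ∀ n x, φ x = n → ∃ p : G.Walk g x, p.length = n := by
    intro n
    induction n with
    | zero =>
      intro x hx
      by_cases hxg : x = g
      · subst hxg
        exact ⟨.nil, rfl⟩
      · obtain ⟨y, -, hy⟩ := hdesc x hxg
        omega
    | succ n ih =>
      intro x hx
      obtain ⟨y, hyx, hy⟩ := hdesc x (by rintro rfl; omega)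
      obtain ⟨p, hp⟩ := ih y (by omega)
      exact ⟨p.concat hyx, by rw [Walk.length_concat, hp]⟩
  have hlower : ∀ {u v : V} (p : G.Walk u v), φ v ≤ φ u + p.length := by
    intro u v p
    induction p with
    | nil => simp
    | cons h p ih =>
      have := hadj _ _ h
      rw [Walk.length_cons]
      omega
  obtain ⟨p, hp⟩ := hwalk _ x rfl
  obtain ⟨q, hq⟩ := (Walk.reachable p).exists_walk_length_eq_dist
  have := hlower q
  have := dist_le p
  omega

theorem Iso.dist_apply {V W : Type*} {G : SimpleGraph V} {H : SimpleGraph W} (f : G ≃g H)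
    (x y : V) : H.dist (f x) (f y) = G.dist x y := by
  by_cases h : G.Reachable x y
  · apply le_antisymm
    · obtain ⟨p, hp⟩ := h.exists_walk_length_eq_dist
      simpa [← hp] using dist_le (p.map f.toHom)
    · obtain ⟨p, hp⟩ := ((Iso.reachable_iff (φ := f)).2 h).exists_walk_length_eq_dist
      simpa [← hp] using dist_le (p.map f.symm.toHom)
  · rw [dist_eq_zero_of_not_reachable h,
      dist_eq_zero_of_not_reachable (mt (Iso.reachable_iff (φ := f)).1 h)]

end SimpleGraph

@[simp]
theorem evdist_mk {V : Type*} (G : SimpleGraph V) (g u v : V) :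
    evdist G g s(u, v) = min (G.dist g u) (G.dist g v) := rfl

theorem evdist_iso {V W : Type*} {G : SimpleGraph V} {H : SimpleGraph W} (f : G ≃g H) (g : V)
    (e : Sym2 V) : evdist H (f g) (e.map f) = evdist G g e := by
  induction e with
  | _ u v => simp [f.dist_apply]

theorem m0count_iso {V W : Type*} {G : SimpleGraph V} {H : SimpleGraph W} (f : G ≃g H)
    (g h : V) : m0count H (f g) (f h) = m0count G g h := by
  have hinj : Function.Injective (Sym2.map f) := Sym2.map.injective f.injective
  have hmem : ∀ e : Sym2 V, e.map f ∈ H.edgeSet ↔ e ∈ G.edgeSet := fun e => by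
    induction e with
    | _ u v => simp [f.map_adj_iff]
  unfold m0count
  rw [← Set.ncard_image_of_injective _ hinj]
  congr 1
  ext e
  obtain ⟨e, rfl⟩ : ∃ e', Sym2.map f e' = e :=
    ⟨e.map f.symm, by simp [Sym2.map_map]⟩
  rw [hinj.mem_set_image, Set.mem_ofPred_eq, Set.mem_ofPred_eq, hmem, evdist_iso, evdist_iso,
    ← Sym2.map_mk, hinj.ne_iff]

theorem m0count_comm {V : Type*} (G : SimpleGraph V) (g h : V) :
    m0count G g h = m0count G h g := by
  simp only [m0count, Sym2.eq_swap (a := g), eq_comm (a := evdist G g _)]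

/-- The subdivision of the complete bipartite graph on `α` and `β`, with subdivision vertices
indexed by `α × β`. -/
def subdividedBiclique (α β : Type*) : SimpleGraph ((α ⊕ β) ⊕ α × β) where
  Adj x y :=
    match x, y with
    | Sum.inl (Sum.inl a), Sum.inr p => p.1 = a
    | Sum.inl (Sum.inr b), Sum.inr p => p.2 = b
    | Sum.inr p, Sum.inl (Sum.inl a) => p.1 = a
    | Sum.inr p, Sum.inl (Sum.inr b) => p.2 = b
    | _, _ => False
  symm := ⟨by rintro ((a | b) | p) ((c | d) | q) h <;> exact h⟩
  loopless := ⟨by rintro ((a | b) | p) h <;> exact h⟩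

namespace subdividedBiclique

variable {α β : Type*}

/-- Edges of the complete bipartite graph correspond to pairs. -/
noncomputable def edgeEquiv (α β : Type*) : α × β ≃ (completeBipartiteGraph α β).edgeSet :=
  Equiv.ofBijective (fun p => ⟨s(Sum.inl p.1, Sum.inr p.2), by simp⟩) <| by
    refine ⟨?_, ?_⟩
    · rintro ⟨a, b⟩ ⟨c, d⟩ h
      simpa using h
    · rintro ⟨e, he⟩
      induction e with
      | _ u v =>
        rcases u with a | b <;> rcases v with c | d <;> simp at he ⊢

theorem coe_edgeEquiv (p : α × β) :
    (edgeEquiv α β p : Sym2 (α ⊕ β)) = s(Sum.inl p.1, Sum.inr p.2) := rfl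

/-- The model is isomorphic to the subdivision graph. -/
noncomputable def isoSubdivision (α β : Type*) :
    subdividedBiclique α β ≃g subdivision (completeBipartiteGraph α β) where
  toEquiv := Equiv.sumCongr (Equiv.refl _) (edgeEquiv α β)
  map_rel_iff' := by
    rintro ((a | b) | p) ((c | d) | q) <;>
      simp [subdivision, subdividedBiclique, coe_edgeEquiv] <;>
      exact eq_comm

/-- Exchanging the two sides. -/
def swapIso (α β : Type*) : subdividedBiclique α β ≃g subdividedBiclique β α where
  toEquiv := Equiv.sumCongr (Equiv.sumComm _ _) (Equiv.prodComm _ _)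
  map_rel_iff' := by
    rintro ((a | b) | p) ((c | d) | q) <;> simp [subdividedBiclique]

theorem dist_inl_inl [DecidableEq α] (a : α) (b : β) (x : (α ⊕ β) ⊕ α × β) :
    (subdividedBiclique α β).dist (Sum.inl (Sum.inl a)) x =
      match x with
      | Sum.inl (Sum.inl i) => if i = a then 0 else 4
      | Sum.inl (Sum.inr _) => 2
      | Sum.inr p => if p.1 = a then 1 else 3 := by
  refine dist_eq_of_potential (fun x : (α ⊕ β) ⊕ α × β => match x with
      | Sum.inl (Sum.inl i) => if i = a then 0 else 4
      | Sum.inl (Sum.inr _) => 2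
      | Sum.inr p => if p.1 = a then 1 else 3) (by simp) ?_ ?_ x
  · rintro ((i | j) | ⟨i, j⟩) ((k | l) | ⟨k, l⟩) h <;>
      simp only [subdividedBiclique] at h ⊢ <;> grind
  · rintro ((i | j) | ⟨i, j⟩) h
    · exact ⟨Sum.inr (i, b), rfl, by grind⟩
    · exact ⟨Sum.inr (a, j), rfl, by simp⟩
    · by_cases hi : i = a
      · exact ⟨Sum.inl (Sum.inl i), rfl, by simp [hi]⟩
      · exact ⟨Sum.inl (Sum.inr j), rfl, by simp [hi]⟩

theorem dist_inr [DecidableEq α] [DecidableEq β] (a : α) (b : β) (x : (α ⊕ β) ⊕ α × β) :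
    (subdividedBiclique α β).dist (Sum.inr (a, b)) x =
      match x with
      | Sum.inl (Sum.inl i) => if i = a then 1 else 3
      | Sum.inl (Sum.inr j) => if j = b then 1 else 3
      | Sum.inr p => (if p.1 = a then 0 else 2) + (if p.2 = b then 0 else 2) := by
  refine dist_eq_of_potential (fun x : (α ⊕ β) ⊕ α × β => match x with
      | Sum.inl (Sum.inl i) => if i = a then 1 else 3
      | Sum.inl (Sum.inr j) => if j = b then 1 else 3
      | Sum.inr p => (if p.1 = a then 0 else 2) + (if p.2 = b then 0 else 2)) (by simp) ?_ ?_ x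
  · rintro ((i | j) | ⟨i, j⟩) ((k | l) | ⟨k, l⟩) h <;>
      simp only [subdividedBiclique] at h ⊢ <;> grind
  · rintro ((i | j) | ⟨i, j⟩) h
    · exact ⟨Sum.inr (i, b), rfl, by grind⟩
    · exact ⟨Sum.inr (a, j), rfl, by grind⟩
    · by_cases hi : i = a
      · exact ⟨Sum.inl (Sum.inl i), rfl, by grind⟩
      · exact ⟨Sum.inl (Sum.inr j), rfl, by grind⟩

theorem m0count_inl_inl [Finite α] [Finite β] (a : α) (b : β) :
    m0count (subdividedBiclique α β) (Sum.inl (Sum.inl a)) (Sum.inr (a, b)) =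
      (Nat.card α - 1) * (Nat.card β - 1) := by
  classical
  let f : α × β → Sym2 ((α ⊕ β) ⊕ α × β) := fun p => s(Sum.inl (Sum.inl p.1), Sum.inr p)
  have hf : Function.Injective f := fun p q h => (by simpa [f] using h : p.1 = q.1 ∧ p = q).2
  have key : {e ∈ (subdividedBiclique α β).edgeSet |
      e ≠ s(Sum.inl (Sum.inl a), Sum.inr (a, b)) ∧
        evdist (subdividedBiclique α β) (Sum.inl (Sum.inl a)) e =
          evdist (subdividedBiclique α β) (Sum.inr (a, b)) e} = f '' ({a}ᶜ ×ˢ {b}ᶜ) := by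
    have hl : ∀ p : α × β, f p ∈ {e ∈ (subdividedBiclique α β).edgeSet |
        e ≠ s(Sum.inl (Sum.inl a), Sum.inr (a, b)) ∧
          evdist (subdividedBiclique α β) (Sum.inl (Sum.inl a)) e =
            evdist (subdividedBiclique α β) (Sum.inr (a, b)) e} ↔ p.1 ≠ a ∧ p.2 ≠ b := by
      rintro ⟨i, j⟩
      have hadj : (subdividedBiclique α β).Adj (Sum.inl (Sum.inl i)) (Sum.inr (i, j)) := rfl
      simp only [f, Set.mem_ofPred_eq, mem_edgeSet, evdist_mk, dist_inl_inl a b, dist_inr, hadj,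
        ne_eq, Sym2.eq_iff]
      grind
    have hr : ∀ p : α × β,
        evdist (subdividedBiclique α β) (Sum.inl (Sum.inl a)) s(Sum.inl (Sum.inr p.2), Sum.inr p) ≠
        evdist (subdividedBiclique α β) (Sum.inr (a, b)) s(Sum.inl (Sum.inr p.2), Sum.inr p) := by
      rintro ⟨i, j⟩
      simp only [evdist_mk, dist_inl_inl a b, dist_inr]
      grind
    ext e
    constructor
    · intro he
      suffices ∃ p, f p = e by
        obtain ⟨p, rfl⟩ := this
        exact ⟨p, (hl p).1 he, rfl⟩
      obtain ⟨hadj, -, heq⟩ := he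
      induction e with
      | _ u v =>
        rcases u with (i | j) | p <;> rcases v with (k | l) | q <;>
          simp only [mem_edgeSet, subdividedBiclique] at hadj <;> subst hadj
        · exact ⟨q, rfl⟩
        · exact absurd heq (hr q)
        · exact ⟨p, Sym2.eq_swap⟩
        · rw [Sym2.eq_swap] at heq
          exact absurd heq (hr p)
    · rintro ⟨p, hp, rfl⟩
      exact (hl p).2 hp
  unfold m0count
  rw [key, Set.ncard_image_of_injective _ hf, Set.ncard_prod, Set.ncard_compl, Set.ncard_compl,
    Set.ncard_singleton, Set.ncard_singleton]

theorem m0count_of_adj [Finite α] [Finite β] {g h : (α ⊕ β) ⊕ α × β}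
    (hadj : (subdividedBiclique α β).Adj g h) :
    m0count (subdividedBiclique α β) g h = (Nat.card α - 1) * (Nat.card β - 1) := by
  have hinr : ∀ p : α × β, m0count (subdividedBiclique α β) (Sum.inl (Sum.inr p.2)) (Sum.inr p) =
      (Nat.card α - 1) * (Nat.card β - 1) := fun p => by
    rw [← m0count_iso (swapIso α β), mul_comm]
    exact m0count_inl_inl p.2 p.1
  rcases g with (a | b) | p <;> rcases h with (c | d) | q <;>
    simp only [subdividedBiclique] at hadj <;> subst hadj
  · exact m0count_inl_inl _ _
  · exact hinr q
  · rw [m0count_comm]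
    exact m0count_inl_inl _ _
  · rw [m0count_comm]
    exact hinr p

end subdividedBiclique

/-- Let `m ≥ 3` and let `S` be the subdivision graph of `K_{m,m}`. For every
edge `f = gh` of `S`, the number of edges `f' ≠ f` equidistant from `g` and `h` is
`m_0(f) = (m - 1)²`. -/
theorem subdivision_completeBipartite_m0count (m : ℕ) (hm : 3 ≤ m)
    (g h : (Fin m ⊕ Fin m) ⊕ (completeBipartiteGraph (Fin m) (Fin m)).edgeSet)
    (hadj : (subdivision (completeBipartiteGraph (Fin m) (Fin m))).Adj g h) :
    m0count (subdivision (completeBipartiteGraph (Fin m) (Fin m))) g h = (m - 1) ^ 2 := by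
  let f := subdividedBiclique.isoSubdivision (Fin m) (Fin m)
  rw [← f.symm.map_adj_iff] at hadj
  rw [← m0count_iso f.symm, subdividedBiclique.m0count_of_adj hadj, Nat.card_fin, sq]
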